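/- arXiv:2101.08913 — 3 statements merged into one kernel-verified Lean document; each statement's English description precedes it below -/
import Mathlib

section
/- Let d, m ≥ 1. Let 𝒢 : ℝ^d × ℝ → ℝ^d be twice continuously differentiable and suppose that for every (X,t) the spatial Jacobian G(X,t) = ∂𝒢/∂X(X,t) ∈ ℝ^{d×d} is invertible. Set g = det G and v = ∂𝒢/∂t. Let F : ℝ^m → ℝ^{m×d} be continuously differentiable and let U : ℝ^d × ℝ → ℝ^m be continuously differentiable. Define the reference solution U_X(X,t) = g(X,t) · U(𝒢(X,t), t) and the transformed flux F_X(W; Θ, ξ) = [(det Θ) F((det Θ)^{-1} W) − W ⊗ ξ] Θ^{-T} for W ∈ ℝ^m, invertible Θ ∈ ℝ^{d×d}, ξ ∈ ℝ^d. Then for every (X,t), ∂_t U_X(X,t) + Σ_{j=1}^d ∂_{X_j}[ F_X(U_X(X,t); G(X,t), v(X,t)) ]_{:,j} = g(X,t) · ( ∂_t U + Σ_{j=1}^d ∂_{x_j} F(U)_{:,j} ) evaluated at (𝒢(X,t), t). In particular, if U satisfies the conservation law ∂_t U + ∇·F(U) = 0 everywhere, then U_X satisfies the transformed conservation law ∂_t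 U_X + ∇_X · F_X(U_X; G, v) = 0 everywhere. -/
open Matrix

/-- Spatial partial derivative of a scalar field on `ℝ^d` in direction `j`. -/
noncomputable def spd (d : ℕ) (f : (Fin d → ℝ) → ℝ) (j : Fin d)
    (X : Fin d → ℝ) : ℝ :=
  fderiv ℝ f X (Pi.single j 1)

/-- Deformation gradient (spatial Jacobian) `G = ∇_X 𝒢` of a time-dependent
mapping `𝒢 : ℝ^d × ℝ → ℝ^d`. -/
noncomputable def defGrad (d : ℕ) (𝒢 : (Fin d → ℝ) × ℝ → Fin d → ℝ)
    (X : Fin d → ℝ) (t : ℝ) : Matrix (Fin d) (Fin d) ℝ :=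
  Matrix.of fun i j => spd d (fun Y => 𝒢 (Y, t) i) j X

/-- Mapping velocity `v = ∂𝒢/∂t`. -/
noncomputable def mapVel (d : ℕ) (𝒢 : (Fin d → ℝ) × ℝ → Fin d → ℝ)
    (X : Fin d → ℝ) (t : ℝ) : Fin d → ℝ :=
  fun i => deriv (fun s => 𝒢 (X, s) i) t

/-- Outer product `W ⊗ ξ`. -/
def outer (m d : ℕ) (W : Fin m → ℝ) (ξ : Fin d → ℝ) :
    Matrix (Fin m) (Fin d) ℝ :=
  Matrix.of fun i j => W i * ξ j

/-- The ALE-transformed flux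
`F_X(W; Θ, ξ) = [(det Θ) F((det Θ)⁻¹ W) − W ⊗ ξ] Θ⁻ᵀ`. -/
noncomputable def transFlux (m d : ℕ)
    (F : (Fin m → ℝ) → Matrix (Fin m) (Fin d) ℝ)
    (W : Fin m → ℝ) (Θ : Matrix (Fin d) (Fin d) ℝ) (ξ : Fin d → ℝ) :
    Matrix (Fin m) (Fin d) ℝ :=
  (Θ.det • F ((Θ.det)⁻¹ • W) - outer m d W ξ) * (Θ⁻¹)ᵀ

section Jacobi

variable {n E : Type*} [Fintype n] [DecidableEq n] [NormedAddCommGroup E] [NormedSpace ℝ E]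

/-- Jacobi's formula. -/
theorem hasFDerivAt_det {A : E → Matrix n n ℝ} {A' : n → n → E →L[ℝ] ℝ} {p : E}
    (h : ∀ i j, HasFDerivAt (fun q => A q i j) (A' i j) p) :
    HasFDerivAt (fun q => (A q).det) (∑ i, ∑ j, (A p).adjugate j i • A' i j) p := by
  let D : ContinuousMultilinearMap ℝ (fun _ : n => n → ℝ) ℝ :=
    { (detRowAlternating (n := n) (R := ℝ)).toMultilinearMap with
      cont := continuous_id.matrix_det }
  have hA : HasFDerivAt (fun q i j => A q i j)
      (ContinuousLinearMap.pi fun i => ContinuousLinearMap.pi fun j => A' i j) p :=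
    hasFDerivAt_pi.2 fun i => hasFDerivAt_pi.2 fun j => h i j
  have hD := (D.hasFDerivAt (fun i j => A p i j)).comp p hA
  refine hD.congr_fderiv ?_
  ext w
  have hrow : ∀ i, ((A p).updateRow i fun j => A' i j w).det
      = ∑ j, (A p).adjugate j i * A' i j w := fun i => by
    rw [← cramer_transpose_apply, cramer_eq_adjugate_mulVec, ← adjugate_transpose]
    simp [mulVec, dotProduct]
  simp only [ContinuousLinearMap.comp_apply, ContinuousMultilinearMap.linearDeriv_apply,
    _root_.sum_apply, _root_.smul_apply, smul_eq_mul]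
  exact Finset.sum_congr rfl fun i _ => hrow i

theorem differentiableAt_adjugate_apply {A : E → Matrix n n ℝ} {p : E}
    (h : ∀ i j, DifferentiableAt ℝ (fun q => A q i j) p) (j k : n) :
    DifferentiableAt ℝ (fun q => (A q).adjugate j k) p := by
  simp only [adjugate_apply]
  refine (hasFDerivAt_det fun a b => DifferentiableAt.hasFDerivAt ?_).differentiableAt
  by_cases hak : a = k
  · subst hak
    simp
  · simpa [updateRow_ne hak] using h a b

theorem fderiv_det_apply {A : E → Matrix n n ℝ} {p : E}
    (h : ∀ i j, DifferentiableAt ℝ (fun q => A q i j) p) (w : E) :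
    fderiv ℝ (fun q => (A q).det) p w
      = ∑ i, ∑ j, (A p).adjugate j i * fderiv ℝ (fun q => A q i j) p w := by
  rw [(hasFDerivAt_det fun i j => (h i j).hasFDerivAt).fderiv]
  simp

theorem sum_mul_fderiv_adjugate {A : E → Matrix n n ℝ} {p : E}
    (h : ∀ i j, DifferentiableAt ℝ (fun q => A q i j) p) (w : E) (i k : n) :
    ∑ l, A p i l * fderiv ℝ (fun q => (A q).adjugate l k) p w
      = (1 : Matrix n n ℝ) i k * fderiv ℝ (fun q => (A q).det) p w
        - ∑ l, fderiv ℝ (fun q => A q i l) p w * (A p).adjugate l k := by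
  have hdet := (hasFDerivAt_det fun i j => (h i j).hasFDerivAt).differentiableAt
  have hadj := differentiableAt_adjugate_apply h
  have key : (fun q => ∑ l, A q i l * (A q).adjugate l k)
      = fun q => (1 : Matrix n n ℝ) i k * (A q).det := by
    funext q
    rw [← mul_apply, mul_adjugate, Matrix.smul_apply, smul_eq_mul, mul_comm]
  have hd : fderiv ℝ (fun q => ∑ l, A q i l * (A q).adjugate l k) p w
      = fderiv ℝ (fun q => (1 : Matrix n n ℝ) i k * (A q).det) p w := by rw [key]
  rw [fderiv_fun_sum fun l _ => (h i l).fun_mul (hadj l k), fderiv_const_mul hdet] at hd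
  simp only [_root_.sum_apply, fderiv_fun_mul (h i _) (hadj _ k),
    _root_.add_apply, _root_.smul_apply, smul_eq_mul,
    Finset.sum_add_distrib] at hd
  rw [← hd]
  simp [mul_comm]

end Jacobi

/-- Piola's identity: the columns of the adjugate of a curl-free invertible matrix field
are divergence free. -/
theorem sum_spd_adjugate_eq_zero {d : ℕ} {A : (Fin d → ℝ) → Matrix (Fin d) (Fin d) ℝ}
    {X : Fin d → ℝ} (h : ∀ i j, DifferentiableAt ℝ (fun Y => A Y i j) X)
    (hsymm : ∀ i j l, spd d (fun Y => A Y i j) l X = spd d (fun Y => A Y i l) j X)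
    (hdet : (A X).det ≠ 0) (k : Fin d) :
    ∑ j, spd d (fun Y => (A Y).adjugate j k) j X = 0 := by
  have hadj : ∀ j w, (A X).det * fderiv ℝ (fun Y => (A Y).adjugate j k) X w
      = (A X).adjugate j k * fderiv ℝ (fun Y => (A Y).det) X w
        - ∑ i, ∑ l, (A X).adjugate j i * fderiv ℝ (fun Y => A Y i l) X w
            * (A X).adjugate l k := by
    intro j w
    have h1 := congrArg (fun u => ((A X).adjugate *ᵥ u) j)
      (funext fun i => sum_mul_fderiv_adjugate h w i k)
    have h2 : (A X).adjugate *ᵥ (A X *ᵥ fun l => fderiv ℝ (fun Y => (A Y).adjugate l k) X w)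
        = (A X).det • fun l => fderiv ℝ (fun Y => (A Y).adjugate l k) X w := by
      rw [mulVec_mulVec, adjugate_mul, smul_mulVec, one_mulVec]
    have h3 := congrFun h2 j
    simp only [mulVec, dotProduct, Pi.smul_apply, smul_eq_mul] at h1 h3
    rw [← h3, h1]
    simp [mul_sub, Finset.sum_sub_distrib, one_apply, Finset.mul_sum, mul_assoc]
  refine (mul_eq_zero.1 ?_).resolve_left hdet
  simp only [spd] at hsymm ⊢
  rw [Finset.mul_sum]
  simp only [hadj, fderiv_det_apply h, Finset.sum_sub_distrib, Finset.mul_sum]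
  rw [sub_eq_zero]
  calc _ = ∑ j, ∑ l, ∑ i, (A X).adjugate j k * ((A X).adjugate l i
              * fderiv ℝ (fun Y => A Y i l) X (Pi.single j 1)) :=
        Finset.sum_congr rfl fun j _ => Finset.sum_comm
    _ = ∑ l, ∑ j, ∑ i, (A X).adjugate j k * ((A X).adjugate l i
              * fderiv ℝ (fun Y => A Y i l) X (Pi.single j 1)) := Finset.sum_comm
    _ = ∑ l, ∑ i, ∑ j, (A X).adjugate j k * ((A X).adjugate l i
              * fderiv ℝ (fun Y => A Y i l) X (Pi.single j 1)) :=
        Finset.sum_congr rfl fun j _ => Finset.sum_comm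
    _ = _ := by
        refine Finset.sum_congr rfl fun l _ => Finset.sum_congr rfl fun i _ =>
          Finset.sum_congr rfl fun j _ => ?_
        rw [hsymm i l j]
        ring

section Slices

variable {E F : Type*} [NormedAddCommGroup E] [NormedSpace ℝ E]
  [NormedAddCommGroup F] [NormedSpace ℝ F] {f : E × ℝ → F} {X : E} {t : ℝ}

theorem hasFDerivAt_slice_left (hf : DifferentiableAt ℝ f (X, t)) :
    HasFDerivAt (fun Y => f (Y, t))
      ((fderiv ℝ f (X, t)).comp (ContinuousLinearMap.inl ℝ E ℝ)) X :=
  hf.hasFDerivAt.comp X (hasFDerivAt_prodMk_left X t)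

theorem hasDerivAt_slice_right (hf : DifferentiableAt ℝ f (X, t)) :
    HasDerivAt (fun s => f (X, s)) (fderiv ℝ f (X, t) (0, 1)) t :=
  hf.hasFDerivAt.comp_hasDerivAt t ((hasDerivAt_const t X).prodMk (hasDerivAt_id t))

theorem ContDiff.fderiv_fderiv_apply_comm {g : E → F} (hg : ContDiff ℝ 2 g) (p a b : E) :
    fderiv ℝ (fun q => fderiv ℝ g q a) p b = fderiv ℝ (fun q => fderiv ℝ g q b) p a := by
  have hd : DifferentiableAt ℝ (fderiv ℝ g) p :=
    ((hg.fderiv_right (m := 1) (by norm_num)).differentiable (by norm_num)) p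
  have hs : IsSymmSndFDerivAt ℝ g p := hg.contDiffAt.isSymmSndFDerivAt (by simp)
  rw [fderiv_clm_apply hd (differentiableAt_const a), fderiv_clm_apply hd (differentiableAt_const b)]
  simpa using hs b a

end Slices

theorem transFlux_det_smul_apply {m d : ℕ} (F : (Fin m → ℝ) → Matrix (Fin m) (Fin d) ℝ)
    (W : Fin m → ℝ) {Θ : Matrix (Fin d) (Fin d) ℝ} (hΘ : Θ.det ≠ 0) (ξ : Fin d → ℝ)
    (i : Fin m) (j : Fin d) :
    transFlux m d F (Θ.det • W) Θ ξ i j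
      = ∑ k, (F W i k - W i * ξ k) * Θ.adjugate j k := by
  rw [transFlux, smul_smul, inv_mul_cancel₀ hΘ, one_smul, mul_apply]
  refine Finset.sum_congr rfl fun k _ => ?_
  simp only [outer, Matrix.sub_apply, Matrix.smul_apply, of_apply, transpose_apply, inv_def,
    Ring.inverse_eq_inv', Pi.smul_apply, smul_eq_mul]
  field_simp

theorem sum_spd_sum_mul_adjugate {d : ℕ} {A : (Fin d → ℝ) → Matrix (Fin d) (Fin d) ℝ}
    {X : Fin d → ℝ} (h : ∀ i j, DifferentiableAt ℝ (fun Y => A Y i j) X)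
    (hsymm : ∀ i j l, spd d (fun Y => A Y i j) l X = spd d (fun Y => A Y i l) j X)
    (hdet : (A X).det ≠ 0) {a : Fin d → (Fin d → ℝ) → ℝ}
    (ha : ∀ k, DifferentiableAt ℝ (a k) X) :
    ∑ j, spd d (fun Y => ∑ k, a k Y * (A Y).adjugate j k) j X
      = ∑ j, ∑ k, (A X).adjugate j k * spd d (a k) j X := by
  have hadj := differentiableAt_adjugate_apply h
  have hterm : ∀ j, spd d (fun Y => ∑ k, a k Y * (A Y).adjugate j k) j X
      = ∑ k, a k X * spd d (fun Y => (A Y).adjugate j k) j X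
        + ∑ k, (A X).adjugate j k * spd d (a k) j X := fun j => by
    simp only [spd]
    rw [fderiv_fun_sum fun k _ => (ha k).fun_mul (hadj j k)]
    simp [fderiv_fun_mul (ha _) (hadj j _), Finset.sum_add_distrib]
  simp only [hterm, Finset.sum_add_distrib]
  rw [Finset.sum_comm]
  simp [← Finset.mul_sum, sum_spd_adjugate_eq_zero h hsymm hdet]

theorem fderiv_apply_eq_sum_spd {d : ℕ} (f : (Fin d → ℝ) → ℝ) (x w : Fin d → ℝ) :
    fderiv ℝ f x w = ∑ l, spd d f l x * w l := by
  conv_lhs => rw [← Finset.univ_sum_single w]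
  rw [map_sum]
  refine Finset.sum_congr rfl fun l _ => ?_
  rw [spd, mul_comm, ← smul_eq_mul, ← map_smul, ← Pi.single_smul, smul_eq_mul, mul_one]

theorem spd_comp {d : ℕ} {f : (Fin d → ℝ) → ℝ} {φ : (Fin d → ℝ) → Fin d → ℝ} {X : Fin d → ℝ}
    (hf : DifferentiableAt ℝ f (φ X)) (hφ : DifferentiableAt ℝ φ X) (j : Fin d) :
    spd d (fun Y => f (φ Y)) j X
      = ∑ l, spd d f l (φ X) * spd d (fun Y => φ Y l) j X := by
  have h : fderiv ℝ (fun Y => f (φ Y)) X = (fderiv ℝ f (φ X)).comp (fderiv ℝ φ X) :=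
    fderiv_comp X hf hφ
  rw [spd, h, ContinuousLinearMap.comp_apply, fderiv_apply_eq_sum_spd]
  simp only [spd, fderiv_apply hφ]
  rfl

theorem sum_adjugate_mul_sum_mul {d : ℕ} (A : Matrix (Fin d) (Fin d) ℝ) (s : Fin d → Fin d → ℝ) :
    ∑ j, ∑ k, A.adjugate j k * ∑ l, s k l * A l j = A.det * ∑ k, s k k := by
  rw [Finset.sum_comm, Finset.mul_sum]
  refine Finset.sum_congr rfl fun k _ => ?_
  simp only [Finset.mul_sum]
  rw [Finset.sum_comm]
  have h : ∀ l, ∑ j, A.adjugate j k * (s k l * A l j) = s k l * (A.det * (1 : Matrix _ _ ℝ) l k) :=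
    fun l => by
      rw [← smul_eq_mul A.det, ← Matrix.smul_apply, ← mul_adjugate, mul_apply, Finset.mul_sum]
      exact Finset.sum_congr rfl fun j _ => by ring
  simp only [h]
  simp [one_apply, mul_comm]

section Kinematics

variable {d : ℕ} {𝒢 : (Fin d → ℝ) × ℝ → Fin d → ℝ}

theorem defGrad_apply (h𝒢 : Differentiable ℝ 𝒢) (X : Fin d → ℝ) (t : ℝ) (i j : Fin d) :
    defGrad d 𝒢 X t i j = fderiv ℝ (fun q => 𝒢 q i) (X, t) (Pi.single j 1, 0) := by
  simp only [defGrad, of_apply, spd]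
  rw [(hasFDerivAt_slice_left (differentiable_pi.1 h𝒢 i (X, t))).fderiv]
  simp

theorem mapVel_apply (h𝒢 : Differentiable ℝ 𝒢) (X : Fin d → ℝ) (t : ℝ) (i : Fin d) :
    mapVel d 𝒢 X t i = fderiv ℝ (fun q => 𝒢 q i) (X, t) (0, 1) :=
  (hasDerivAt_slice_right (differentiable_pi.1 h𝒢 i (X, t))).deriv

theorem differentiable_fderiv_component_apply (h𝒢 : ContDiff ℝ 2 𝒢) (i : Fin d)
    (w : (Fin d → ℝ) × ℝ) : Differentiable ℝ fun q => fderiv ℝ (fun q => 𝒢 q i) q w :=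
  ((((contDiff_pi.1 h𝒢 i).fderiv_right (m := 1) (by norm_num)).clm_apply
    contDiff_const).differentiable (by norm_num))

theorem differentiable_defGrad_apply (h𝒢 : ContDiff ℝ 2 𝒢) (i j : Fin d) :
    Differentiable ℝ fun q : (Fin d → ℝ) × ℝ => defGrad d 𝒢 q.1 q.2 i j := by
  simp only [defGrad_apply (h𝒢.differentiable (by norm_num))]
  exact differentiable_fderiv_component_apply h𝒢 i _

theorem differentiable_mapVel_apply (h𝒢 : ContDiff ℝ 2 𝒢) (i : Fin d) :
    Differentiable ℝ fun q : (Fin d → ℝ) × ℝ => mapVel d 𝒢 q.1 q.2 i := by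
  simp only [mapVel_apply (h𝒢.differentiable (by norm_num))]
  exact differentiable_fderiv_component_apply h𝒢 i _

theorem spd_defGrad_comm (h𝒢 : ContDiff ℝ 2 𝒢) (X : Fin d → ℝ) (t : ℝ) (i j l : Fin d) :
    spd d (fun Y => defGrad d 𝒢 Y t i j) l X = spd d (fun Y => defGrad d 𝒢 Y t i l) j X := by
  have h (j l : Fin d) : spd d (fun Y => defGrad d 𝒢 Y t i j) l X
      = fderiv ℝ (fun q => fderiv ℝ (fun q => 𝒢 q i) q (Pi.single j 1, 0)) (X, t)
          (Pi.single l 1, 0) := by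
    simp only [defGrad_apply (h𝒢.differentiable (by norm_num)), spd]
    rw [(hasFDerivAt_slice_left (differentiable_fderiv_component_apply h𝒢 i _ (X, t))).fderiv]
    simp
  rw [h, h, (contDiff_pi.1 h𝒢 i).fderiv_fderiv_apply_comm]

theorem deriv_defGrad_apply (h𝒢 : ContDiff ℝ 2 𝒢) (X : Fin d → ℝ) (t : ℝ) (i j : Fin d) :
    deriv (fun s => defGrad d 𝒢 X s i j) t = spd d (fun Y => mapVel d 𝒢 Y t i) j X := by
  simp only [defGrad_apply (h𝒢.differentiable (by norm_num)),
    mapVel_apply (h𝒢.differentiable (by norm_num)), spd]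
  rw [(hasFDerivAt_slice_left (differentiable_fderiv_component_apply h𝒢 i _ (X, t))).fderiv,
    (hasDerivAt_slice_right (differentiable_fderiv_component_apply h𝒢 i _ (X, t))).deriv,
    (contDiff_pi.1 h𝒢 i).fderiv_fderiv_apply_comm]
  simp

theorem hasDerivAt_det_defGrad (h𝒢 : ContDiff ℝ 2 𝒢) (X : Fin d → ℝ) (t : ℝ) :
    HasDerivAt (fun s => (defGrad d 𝒢 X s).det)
      (∑ j, ∑ k, (defGrad d 𝒢 X t).adjugate j k * spd d (fun Y => mapVel d 𝒢 Y t k) j X) t := by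
  have h : ∀ i j, DifferentiableAt ℝ (fun s => defGrad d 𝒢 X s i j) t := fun i j =>
    (hasDerivAt_slice_right (differentiable_defGrad_apply h𝒢 i j (X, t))).differentiableAt
  have hd := (hasFDerivAt_det fun i j => (h i j).hasFDerivAt).hasDerivAt
  convert hd using 1
  rw [Finset.sum_comm]
  simp [deriv_defGrad_apply h𝒢]

theorem hasDerivAt_comp_motion (h𝒢 : Differentiable ℝ 𝒢) {u : (Fin d → ℝ) × ℝ → ℝ}
    (hu : Differentiable ℝ u) (X : Fin d → ℝ) (t : ℝ) :
    HasDerivAt (fun s => u (𝒢 (X, s), s))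
      (deriv (fun s => u (𝒢 (X, t), s)) t
        + ∑ l, spd d (fun y => u (y, t)) l (𝒢 (X, t)) * mapVel d 𝒢 X t l) t := by
  have hφ : HasDerivAt (fun s => 𝒢 (X, s)) (mapVel d 𝒢 X t) t :=
    hasDerivAt_pi.2 fun i =>
      (hasDerivAt_slice_right (differentiable_pi.1 h𝒢 i (X, t))).differentiableAt.hasDerivAt
  have h := (hu (𝒢 (X, t), t)).hasFDerivAt.comp_hasDerivAt
    (f := fun s => (𝒢 (X, s), s)) t (hφ.prodMk (hasDerivAt_id t))
  refine h.congr_deriv ?_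
  rw [(hasDerivAt_slice_right (hu _)).deriv, ← fderiv_apply_eq_sum_spd (fun y => u (y, t)),
    (hasFDerivAt_slice_left (hu _)).fderiv, ContinuousLinearMap.comp_apply, ← map_add]
  simp

end Kinematics

/-- The reference residual of the pulled-back field equals `g` times the physical residual. -/
theorem ale_residual_eq {d m : ℕ} {𝒢 : (Fin d → ℝ) × ℝ → Fin d → ℝ} (h𝒢 : ContDiff ℝ 2 𝒢)
    (hG : ∀ (X : Fin d → ℝ) (t : ℝ), IsUnit (defGrad d 𝒢 X t))
    {F : (Fin m → ℝ) → Fin m → Fin d → ℝ} (hF : ContDiff ℝ 1 F)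
    {U : (Fin d → ℝ) × ℝ → Fin m → ℝ} (hU : ContDiff ℝ 1 U)
    (X : Fin d → ℝ) (t : ℝ) (i : Fin m) :
    deriv (fun s => ((defGrad d 𝒢 X s).det • U (𝒢 (X, s), s)) i) t
        + ∑ j, spd d (fun Y =>
            transFlux m d (fun V => Matrix.of (F V)) ((defGrad d 𝒢 Y t).det • U (𝒢 (Y, t), t))
              (defGrad d 𝒢 Y t) (mapVel d 𝒢 Y t) i j) j X
      = (defGrad d 𝒢 X t).det *
          (deriv (fun s => U (𝒢 (X, t), s) i) t
            + ∑ j, spd d (fun y => F (U (y, t)) i j) j (𝒢 (X, t))) := by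
  have hdet : ∀ Y, (defGrad d 𝒢 Y t).det ≠ 0 := fun Y =>
    ((isUnit_iff_isUnit_det _).1 (hG Y t)).ne_zero
  have hg : Differentiable ℝ 𝒢 := h𝒢.differentiable (by norm_num)
  have hu : Differentiable ℝ fun q => U q i :=
    differentiable_pi.1 (hU.differentiable (by norm_num)) i
  have hf : ∀ k, Differentiable ℝ fun y => F (U (y, t)) i k := fun k => by
    have hFd := differentiable_pi.1 (differentiable_pi.1 (hF.differentiable (by norm_num)) i) k
    have hUd := hU.differentiable (by norm_num)
    exact hFd.comp (hUd.comp (differentiable_id.prodMk (differentiable_const t)))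
  have hut : Differentiable ℝ fun y => U (y, t) i := fun y =>
    (hasFDerivAt_slice_left (hu (y, t))).differentiableAt
  have hφ : DifferentiableAt ℝ (fun Y => 𝒢 (Y, t)) X :=
    (hasFDerivAt_slice_left (hg (X, t))).differentiableAt
  have hv : ∀ k, DifferentiableAt ℝ (fun Y => mapVel d 𝒢 Y t k) X := fun k =>
    (hasFDerivAt_slice_left (differentiable_mapVel_apply h𝒢 k (X, t))).differentiableAt
  have hA : ∀ a b, DifferentiableAt ℝ (fun Y => defGrad d 𝒢 Y t a b) X := fun a b =>
    (hasFDerivAt_slice_left (differentiable_defGrad_apply h𝒢 a b (X, t))).differentiableAt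
  have hfφ : ∀ k, DifferentiableAt ℝ (fun Y => F (U (𝒢 (Y, t), t)) i k) X := fun k =>
    (hf k _).comp X hφ
  have huφ : DifferentiableAt ℝ (fun Y => U (𝒢 (Y, t), t) i) X := (hut _).comp X hφ
  have hspd : ∀ j k, spd d (fun Y => F (U (𝒢 (Y, t), t)) i k
        - U (𝒢 (Y, t), t) i * mapVel d 𝒢 Y t k) j X
      = ∑ l, (spd d (fun y => F (U (y, t)) i k) l (𝒢 (X, t))
          - mapVel d 𝒢 X t k * spd d (fun y => U (y, t) i) l (𝒢 (X, t))) * defGrad d 𝒢 X t l j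
        - U (𝒢 (X, t), t) i * spd d (fun Y => mapVel d 𝒢 Y t k) j X := fun j k => by
    have h1 := spd_comp (hf k _) hφ j
    have h2 := spd_comp (hut _) hφ j
    have h3 : spd d (fun Y => F (U (𝒢 (Y, t), t)) i k - U (𝒢 (Y, t), t) i * mapVel d 𝒢 Y t k) j X
        = spd d (fun Y => F (U (𝒢 (Y, t), t)) i k) j X
          - (U (𝒢 (X, t), t) i * spd d (fun Y => mapVel d 𝒢 Y t k) j X
            + mapVel d 𝒢 X t k * spd d (fun Y => U (𝒢 (Y, t), t) i) j X) := by
      simp only [spd]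
      rw [fderiv_fun_sub (hfφ k) (huφ.fun_mul (hv k)), fderiv_fun_mul huφ (hv k)]
      simp
    rw [h3, h1, h2]
    simp only [sub_mul, Finset.sum_sub_distrib, mul_assoc, ← Finset.mul_sum, defGrad, of_apply]
    ring
  have htime := ((hasDerivAt_det_defGrad h𝒢 X t).fun_mul (hasDerivAt_comp_motion hg hu X t)).deriv
  have hdiv := sum_spd_sum_mul_adjugate hA (spd_defGrad_comm h𝒢 X t) (hdet X)
    fun k => (hfφ k).fun_sub (huφ.fun_mul (hv k))
  simp only [transFlux_det_smul_apply _ _ (hdet _), of_apply, Pi.smul_apply, smul_eq_mul]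
  refine (congrArg₂ (· + ·) htime hdiv).trans ?_
  have hsum : ∑ j, ∑ k, (defGrad d 𝒢 X t).adjugate j k
        * spd d (fun Y => F (U (𝒢 (Y, t), t)) i k - U (𝒢 (Y, t), t) i * mapVel d 𝒢 Y t k) j X
      = (defGrad d 𝒢 X t).det * ∑ k, (spd d (fun y => F (U (y, t)) i k) k (𝒢 (X, t))
          - mapVel d 𝒢 X t k * spd d (fun y => U (y, t) i) k (𝒢 (X, t)))
        - U (𝒢 (X, t), t) i * ∑ j, ∑ k, (defGrad d 𝒢 X t).adjugate j k
            * spd d (fun Y => mapVel d 𝒢 Y t k) j X := by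
    rw [← sum_adjugate_mul_sum_mul _ fun k l => spd d (fun y => F (U (y, t)) i k) l (𝒢 (X, t))
      - mapVel d 𝒢 X t k * spd d (fun y => U (y, t) i) l (𝒢 (X, t))]
    simp only [hspd, Finset.mul_sum _ _ (U _ _), ← Finset.sum_sub_distrib]
    exact Finset.sum_congr rfl fun j _ => Finset.sum_congr rfl fun k _ => by ring
  refine (congrArg _ hsum).trans ?_
  simp only [Finset.sum_sub_distrib, mul_comm (mapVel d 𝒢 X t _)]
  ring

/-- ALE transformation of an inviscid conservation law: with
`U_X(X,t) = g(X,t)·U(𝒢(X,t),t)`, the reference-domain residual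
`∂ₜU_X + ∇_X·F_X(U_X; G, v)` equals `g` times the physical residual
`∂ₜU + ∇·F(U)` evaluated at `(𝒢(X,t), t)`; in particular, solutions of the
physical conservation law yield solutions of the transformed one. -/
theorem stmt_0 (d m : ℕ) (hd : 1 ≤ d) (hm : 1 ≤ m)
    (𝒢 : (Fin d → ℝ) × ℝ → Fin d → ℝ) (h𝒢 : ContDiff ℝ 2 𝒢)
    (hG : ∀ (X : Fin d → ℝ) (t : ℝ), IsUnit (defGrad d 𝒢 X t))
    (F : (Fin m → ℝ) → Fin m → Fin d → ℝ) (hF : ContDiff ℝ 1 F)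
    (U : (Fin d → ℝ) × ℝ → Fin m → ℝ) (hU : ContDiff ℝ 1 U)
    (UX : (Fin d → ℝ) × ℝ → Fin m → ℝ)
    (hUX : ∀ (X : Fin d → ℝ) (t : ℝ),
      UX (X, t) = (defGrad d 𝒢 X t).det • U (𝒢 (X, t), t)) :
    (∀ (X : Fin d → ℝ) (t : ℝ) (i : Fin m),
      deriv (fun s => UX (X, s) i) t
        + ∑ j, spd d (fun Y =>
            transFlux m d (fun V => Matrix.of (F V)) (UX (Y, t))
              (defGrad d 𝒢 Y t) (mapVel d 𝒢 Y t) i j) j X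
      = (defGrad d 𝒢 X t).det *
          (deriv (fun s => U (𝒢 (X, t), s) i) t
            + ∑ j, spd d (fun y => F (U (y, t)) i j) j (𝒢 (X, t))))
    ∧ ((∀ (x : Fin d → ℝ) (t : ℝ) (i : Fin m),
          deriv (fun s => U (x, s) i) t
            + ∑ j, spd d (fun y => F (U (y, t)) i j) j x = 0) →
        ∀ (X : Fin d → ℝ) (t : ℝ) (i : Fin m),
          deriv (fun s => UX (X, s) i) t
            + ∑ j, spd d (fun Y =>
                transFlux m d (fun V => Matrix.of (F V)) (UX (Y, t))
                  (defGrad d 𝒢 Y t) (mapVel d 𝒢 Y t) i j) j X = 0) := by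
  have key := fun X t i => ale_residual_eq h𝒢 hG hF hU X t i
  simp only [← hUX] at key
  exact ⟨key, fun h X t i => by rw [key, h, mul_zero]⟩
end

section
/- Bounds for the smoothed absolute value: For every k > 0 and every x ∈ ℝ, 0 ≤ x·tanh(kx) ≤ |x| and |x| − x·tanh(kx) ≤ 1/(e·k), where e is Euler's number. -/
theorem Real.tanh_eq_one_sub (t : ℝ) : Real.tanh t = 1 - 2 / (Real.exp (2 * t) + 1) := by
  have h := Real.exp_pos t
  rw [Real.tanh_eq_sinh_div_cosh, Real.sinh_eq, Real.cosh_eq, Real.exp_neg, two_mul,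
    Real.exp_add]
  field_simp
  ring

theorem smoothedAbs_bounds_of_nonneg {k x : ℝ} (hk : 0 < k) (hx : 0 ≤ x) :
    0 ≤ x * Real.tanh (k * x) ∧ x * Real.tanh (k * x) ≤ x ∧
      x - x * Real.tanh (k * x) ≤ 1 / (Real.exp 1 * k) := by
  have hE : 1 ≤ Real.exp (2 * (k * x)) := Real.one_le_exp (by positivity)
  have he := Real.exp_pos 1
  have hu : Real.exp 1 * (2 * (k * x)) ≤ Real.exp (2 * (k * x)) := by
    have h := Real.add_one_le_exp (2 * (k * x) - 1)
    rwa [sub_add_cancel, Real.exp_sub, le_div_iff₀ he, mul_comm] at h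
  rw [Real.tanh_eq_one_sub]
  refine ⟨mul_nonneg hx ?_, mul_le_of_le_one_right hx ?_, ?_⟩
  · rw [sub_nonneg, div_le_one (by positivity)]
    linarith
  · exact sub_le_self _ (by positivity)
  · rw [show x - x * (1 - 2 / (Real.exp (2 * (k * x)) + 1))
      = 2 * x / (Real.exp (2 * (k * x)) + 1) by ring,
      div_le_div_iff₀ (by positivity) (by positivity)]
    linarith

/-- Bounds for the smoothed absolute value `|x|ₛ = x·tanh(kx)`. -/
theorem stmt_6 (k x : ℝ) (hk : 0 < k) :
    0 ≤ x * Real.tanh (k * x) ∧ x * Real.tanh (k * x) ≤ |x| ∧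
      |x| - x * Real.tanh (k * x) ≤ 1 / (Real.exp 1 * k) := by
  have h : x * Real.tanh (k * x) = |x| * Real.tanh (k * |x|) := by
    rcases abs_choice x with h | h <;> simp [h, Real.tanh_neg]
  rw [h]
  exact smoothedAbs_bounds_of_nonneg hk (abs_nonneg x)
end

section
/- Order and structural conditions for the three-stage DIRK3 tableau: Let β ∈ ℝ satisfy 6β³ − 18β² + 9β − 1 = 0, and define γ = −(6β² − 16β + 1)/4 and ω = (6β² − 20β + 5)/4. Define the Butcher tableau with A = [[β, 0, 0], [(1+β)/2 − β, β, 0], [γ, ω, β]], b = (γ, ω, β), and c = (β, (1+β)/2, γ + ω + β). Then: (i) γ + ω + β = 1 (this holds identically in β, so c₃ = 1); (ii) row-sum consistency: c_i = Σ_j A_{ij} for i = 1, 2, 3; (iii) stiff accuracy: A_{3j} = b_j for j = 1, 2, 3; and (iv) the third-order conditions hold: Σ_i b_i = 1, Σ_i b_i c_i = 1/2, Σ_i b_i c_i² = 1/3, and Σ_{i,j} b_i A_{ij} c_j = 1/6. -/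
/-- Order and structural conditions for the three-stage DIRK3 Butcher tableau. -/
theorem stmt_10 (β : ℝ) (hβ : 6 * β ^ 3 - 18 * β ^ 2 + 9 * β - 1 = 0)
    (γ ω : ℝ) (hγ : γ = -(6 * β ^ 2 - 16 * β + 1) / 4)
    (hω : ω = (6 * β ^ 2 - 20 * β + 5) / 4)
    (A : Matrix (Fin 3) (Fin 3) ℝ)
    (hA : A = !![β, 0, 0; (1 + β) / 2 - β, β, 0; γ, ω, β])
    (b : Fin 3 → ℝ) (hb : b = ![γ, ω, β])
    (c : Fin 3 → ℝ) (hc : c = ![β, (1 + β) / 2, γ + ω + β]) :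
    (γ + ω + β = 1)
    ∧ (∀ i, c i = ∑ j, A i j)
    ∧ (∀ j, A 2 j = b j)
    ∧ (∑ i, b i = 1)
    ∧ (∑ i, b i * c i = 1 / 2)
    ∧ (∑ i, b i * c i ^ 2 = 1 / 3)
    ∧ (∑ i, ∑ j, b i * A i j * c j = 1 / 6) := by
  have hsum : γ + ω + β = 1 := by rw [hγ, hω]; ring
  rw [hsum] at hc
  refine ⟨hsum, ?_, ?_, ?_, ?_, ?_, ?_⟩
  · intro i
    fin_cases i <;> simp [hA, hc, Fin.sum_univ_three, hsum]
  · intro j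
    fin_cases j <;> simp [hA, hb]
  · simpa [hb, Fin.sum_univ_three] using hsum
  · simp only [hb, hc, Fin.sum_univ_three, Matrix.cons_val]
    rw [hγ, hω]
    linear_combination (-1 / 8) * hβ
  · simp only [hb, hc, Fin.sum_univ_three, Matrix.cons_val]
    rw [hγ, hω]
    linear_combination (-3 / 16 * β + 1 / 48) * hβ
  · simp only [hA, hb, hc, Fin.sum_univ_three, Matrix.of_apply, Matrix.cons_val]
    rw [hγ, hω]
    linear_combination (-3 / 8 * β + 1 / 6) * hβ
end
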